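/- Let a, b, c, e ∈ ℂ with Re(e − a − b) > 0 and with e, c, a+c−e+1, b+c−e+1, a+b+c−e+1 not nonpositive integers. For n ∈ ℕ define S(n) := [Γ(a+c−e+1+n) Γ(b+c−e+1+n) / (Γ(c−e+1+n) Γ(a+b+c−e+1+n))] · ∑_{k=0}^∞ (a)_k (b)_k (c+n)_k / ((e)_k (a+b+c−e+1+n)_k · k!). Then lim_{n→∞} S(n) = Γ(e) Γ(e−a−b) / (Γ(e−a) Γ(e−b)). -/

import Mathlib

open Complex Filter

/-- Pochhammer symbol `(a)_k = a (a+1) ⋯ (a+k-1)`. -/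
noncomputable def poch (a : ℂ) (k : ℕ) : ℂ := ∏ i ∈ Finset.range k, (a + i)

/-- The normalized sum `S(n)` for the nonterminating Saalschützian series. -/
noncomputable def Ssaal (a b c e : ℂ) (n : ℕ) : ℂ :=
  Complex.Gamma (a + c - e + 1 + n) * Complex.Gamma (b + c - e + 1 + n) /
      (Complex.Gamma (c - e + 1 + n) * Complex.Gamma (a + b + c - e + 1 + n)) *
    ∑' k : ℕ, poch a k * poch b k * poch (c + n) k /
      (poch e k * poch (a + b + c - e + 1 + n) k * (Nat.factorial k : ℂ))

theorem poch_succ (z : ℂ) (k : ℕ) : poch z (k + 1) = poch z k * (z + k) :=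
  Finset.prod_range_succ _ _

theorem poch_add (z : ℂ) (n k : ℕ) : poch z (n + k) = poch z n * poch (z + n) k := by
  simp only [poch, Finset.prod_range_add]
  congr 1
  exact Finset.prod_congr rfl fun i _ => by push_cast; ring

theorem poch_ne_zero {z : ℂ} (hz : ∀ m : ℕ, z ≠ -(m : ℂ)) (k : ℕ) : poch z k ≠ 0 :=
  Finset.prod_ne_zero_iff.2 fun i _ h => hz i (eq_neg_of_add_eq_zero_left h)

theorem add_natCast_ne_neg_natCast {z : ℂ} (hz : ∀ m : ℕ, z ≠ -(m : ℂ)) (n m : ℕ) :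
    z + n ≠ -(m : ℂ) := fun h => hz (n + m) (by push_cast; linear_combination h)

/-- `Γ(z + n) = Γ(z) (z)_n`. -/
theorem Gamma_add_natCast_eq {z : ℂ} (hz : ∀ m : ℕ, z ≠ -(m : ℂ)) (n : ℕ) :
    Gamma (z + n) = Gamma z * poch z n := by
  induction n with
  | zero => simp [poch]
  | succ n ih =>
    have h0 : z + n ≠ 0 := fun h => hz n (eq_neg_of_add_eq_zero_left h)
    rw [poch_succ, ← mul_assoc, ← ih, mul_comm, ← Gamma_add_one _ h0]
    push_cast
    ring_nf

theorem natCast_succ_cpow_ne_zero (m : ℕ) (z : ℂ) : ((m + 1 : ℕ) : ℂ) ^ z ≠ 0 := by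
  push_cast
  exact natCast_add_one_cpow_ne_zero m z

/-- The Pochhammer symbol `(z)_m` divided by its growth order `m! (m + 1) ^ (z - 1)`. -/
noncomputable def pochNormalized (z : ℂ) (m : ℕ) : ℂ :=
  poch z m / ((m.factorial : ℂ) * ((m + 1 : ℕ) : ℂ) ^ (z - 1))

theorem poch_eq_pochNormalized_mul (z : ℂ) (m : ℕ) :
    poch z m = pochNormalized z m * ((m.factorial : ℂ) * ((m + 1 : ℕ) : ℂ) ^ (z - 1)) := by
  rw [pochNormalized, div_mul_cancel₀]
  exact mul_ne_zero (by exact_mod_cast m.factorial_ne_zero) (natCast_succ_cpow_ne_zero m _)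

theorem pochNormalized_ne_zero {z : ℂ} (hz : ∀ m : ℕ, z ≠ -(m : ℂ)) (m : ℕ) :
    pochNormalized z m ≠ 0 := by
  intro h
  apply poch_ne_zero hz m
  rw [poch_eq_pochNormalized_mul, h, zero_mul]

theorem tendsto_inv_GammaSeq (z : ℂ) :
    Tendsto (fun m : ℕ => (GammaSeq z m)⁻¹) atTop (nhds (Gamma z)⁻¹) := by
  by_cases hz : ∀ m : ℕ, z ≠ -(m : ℂ)
  · exact (GammaSeq_tendsto_Gamma z).inv₀ (Gamma_ne_zero hz)
  · push Not at hz
    obtain ⟨j, rfl⟩ := hz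
    rw [Gamma_neg_nat_eq_zero, inv_zero]
    refine tendsto_const_nhds.congr' ?_
    filter_upwards [eventually_ge_atTop j] with m hm
    have : ∏ i ∈ Finset.range (m + 1), (-(j : ℂ) + i) = 0 :=
      Finset.prod_eq_zero (Finset.mem_range.2 (Nat.lt_succ_of_le hm)) (by simp)
    rw [GammaSeq, this, div_zero, inv_zero]

theorem tendsto_pochNormalized (z : ℂ) :
    Tendsto (pochNormalized z) atTop (nhds (Gamma z)⁻¹) := by
  rw [← tendsto_add_atTop_iff_nat 1]
  have h1 : Tendsto (fun m : ℕ => (m : ℂ) / ((m : ℂ) + 2)) atTop (nhds 1) :=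
    tendsto_natCast_div_add_atTop (2 : ℂ)
  have h2 : Tendsto (fun m : ℕ => (m : ℂ) / ((m : ℂ) + 1)) atTop (nhds 1) :=
    tendsto_natCast_div_add_atTop (1 : ℂ)
  have h3 : Tendsto (fun m : ℕ => ((m : ℂ) / ((m : ℂ) + 2)) ^ z) atTop (nhds 1) := by
    simpa using h1.cpow (tendsto_const_nhds (x := z)) (by simp)
  have h4 := (((tendsto_inv_GammaSeq z).mul h3).mul h2).mul (h1.inv₀ one_ne_zero)
  simp only [mul_one, inv_one] at h4
  refine h4.congr' ?_
  filter_upwards [eventually_gt_atTop 0] with m hm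
  have hm0 : (m : ℂ) ≠ 0 := by exact_mod_cast hm.ne'
  have hm1 : (m : ℂ) + 1 ≠ 0 := by exact_mod_cast m.succ_ne_zero
  have hm2 : (m : ℂ) + 2 ≠ 0 := by exact_mod_cast (m + 1).succ_ne_zero
  have hf : (m.factorial : ℂ) ≠ 0 := by exact_mod_cast m.factorial_ne_zero
  have hp : (m : ℂ) ^ z = ((m : ℂ) / ((m : ℂ) + 2)) ^ z * ((m : ℂ) + 2) ^ z := by
    have := mul_cpow_ofReal_nonneg (a := (m : ℝ) / (m + 2)) (b := m + 2)
      (by positivity) (by positivity) z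
    push_cast at this
    rw [← this, div_mul_cancel₀ _ hm2]
  have hmz : (m : ℂ) ^ z ≠ 0 := by simp [cpow_eq_zero_iff, hm0]
  have hmz2 : ((m : ℂ) + 2) ^ z ≠ 0 := by simp [cpow_eq_zero_iff, hm2]
  have e1 : ((m + 1 + 1 : ℕ) : ℂ) = (m : ℂ) + 2 := by push_cast; ring
  rw [pochNormalized, e1, cpow_sub _ _ hm2, cpow_one, GammaSeq, Nat.factorial_succ]
  rw [eq_div_of_mul_eq hmz2 hp.symm]
  push_cast
  rw [poch]
  field_simp

theorem exists_norm_pochNormalized_le (z : ℂ) :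
    ∃ K : ℝ, 0 < K ∧ ∀ m, ‖pochNormalized z m‖ ≤ K := by
  obtain ⟨K, hK⟩ := (tendsto_pochNormalized z).norm.bddAbove_range
  exact ⟨max K 1, by positivity, fun m => (hK ⟨m, rfl⟩).trans (le_max_left _ _)⟩

theorem exists_norm_inv_pochNormalized_le {z : ℂ} (hz : ∀ m : ℕ, z ≠ -(m : ℂ)) :
    ∃ K : ℝ, 0 < K ∧ ∀ m, ‖(pochNormalized z m)⁻¹‖ ≤ K := by
  obtain ⟨K, hK⟩ :=
    ((tendsto_pochNormalized z).inv₀ (inv_ne_zero (Gamma_ne_zero hz))).norm.bddAbove_range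
  exact ⟨max K 1, by positivity, fun m => (hK ⟨m, rfl⟩).trans (le_max_left _ _)⟩

theorem tendsto_poch_mul_div {p q r s : ℂ} (h : p + q = r + s) (hr : ∀ m : ℕ, r ≠ -(m : ℂ))
    (hs : ∀ m : ℕ, s ≠ -(m : ℂ)) :
    Tendsto (fun n => poch p n * poch q n / (poch r n * poch s n)) atTop
      (nhds (Gamma r * Gamma s / (Gamma p * Gamma q))) := by
  have key := ((tendsto_pochNormalized p).mul (tendsto_pochNormalized q)).div
    ((tendsto_pochNormalized r).mul (tendsto_pochNormalized s))
    (mul_ne_zero (inv_ne_zero (Gamma_ne_zero hr)) (inv_ne_zero (Gamma_ne_zero hs)))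
  have e : (Gamma p)⁻¹ * (Gamma q)⁻¹ / ((Gamma r)⁻¹ * (Gamma s)⁻¹) =
      Gamma r * Gamma s / (Gamma p * Gamma q) := by
    simp only [div_eq_mul_inv, mul_inv, inv_inv]
    ring
  rw [e] at key
  refine key.congr fun n => ?_
  have hf : (n.factorial : ℂ) ≠ 0 := by exact_mod_cast n.factorial_ne_zero
  have hn : ((n + 1 : ℕ) : ℂ) ≠ 0 := by exact_mod_cast n.succ_ne_zero
  have hpow : ((n + 1 : ℕ) : ℂ) ^ (p - 1) * ((n + 1 : ℕ) : ℂ) ^ (q - 1) =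
      ((n + 1 : ℕ) : ℂ) ^ (r - 1) * ((n + 1 : ℕ) : ℂ) ^ (s - 1) := by
    rw [← cpow_add _ _ hn, ← cpow_add _ _ hn]
    congr 1
    linear_combination h
  have h1 : ((n + 1 : ℕ) : ℂ) ^ (r - 1) ≠ 0 := natCast_succ_cpow_ne_zero _ _
  have h2 : ((n + 1 : ℕ) : ℂ) ^ (s - 1) ≠ 0 := natCast_succ_cpow_ne_zero _ _
  have h3 := pochNormalized_ne_zero hr n
  have h4 := pochNormalized_ne_zero hs n
  simp only [poch_eq_pochNormalized_mul, Pi.div_apply]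
  rw [div_eq_div_iff (mul_ne_zero h3 h4) (by positivity)]
  linear_combination (-pochNormalized p n * pochNormalized q n * pochNormalized r n *
    pochNormalized s n * n.factorial ^ 2) * hpow

theorem tendsto_Gamma_mul_div {p q r s : ℂ} (h : p + q = r + s) :
    Tendsto (fun n : ℕ => Gamma (p + n) * Gamma (q + n) / (Gamma (r + n) * Gamma (s + n))) atTop
      (nhds 1) := by
  have hev (z : ℂ) : ∀ᶠ N : ℕ in atTop, ∀ m : ℕ, z + N ≠ -(m : ℂ) := by
    filter_upwards [eventually_gt_atTop ⌈-z.re⌉₊] with N hN m hm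
    have h1 := congrArg re hm
    have h2 := Nat.lt_of_ceil_lt hN
    have h3 : (0 : ℝ) ≤ m := m.cast_nonneg
    simp at h1
    linarith
  obtain ⟨N, hp, hq, hr, hs⟩ :=
    ((hev p).and ((hev q).and ((hev r).and (hev s)))).exists
  rw [← tendsto_add_atTop_iff_nat N]
  have key := (tendsto_poch_mul_div (p := p + N) (q := q + N) (r := r + N) (s := s + N)
    (by linear_combination h) hr hs).const_mul
      (Gamma (p + N) * Gamma (q + N) / (Gamma (r + N) * Gamma (s + N)))
  have gp := Gamma_ne_zero hp
  have gq := Gamma_ne_zero hq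
  have gr := Gamma_ne_zero hr
  have gs := Gamma_ne_zero hs
  rw [div_mul_div_cancel₀ (mul_ne_zero gr gs), div_self (mul_ne_zero gp gq)] at key
  refine key.congr fun n => ?_
  have e (z : ℂ) : z + ((n + N : ℕ) : ℂ) = z + N + n := by push_cast; ring
  simp only [e, Gamma_add_natCast_eq hp, Gamma_add_natCast_eq hq, Gamma_add_natCast_eq hr,
    Gamma_add_natCast_eq hs]
  rw [div_mul_div_comm]
  ring

/-- The general term of the Gauss series `₂F₁(a, b; e; 1)`. -/
noncomputable def gaussTerm (a b e : ℂ) (k : ℕ) : ℂ :=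
  poch a k * poch b k / (poch e k * (k.factorial : ℂ))

theorem exists_norm_gaussTerm_le (a b : ℂ) {e : ℂ} (he : ∀ m : ℕ, e ≠ -(m : ℂ)) :
    ∃ K : ℝ, 0 < K ∧ ∀ k : ℕ,
      ‖gaussTerm a b e k‖ ≤ K * ((k + 1 : ℕ) : ℝ) ^ (-(e - a - b).re - 1) := by
  obtain ⟨A, hA, hA'⟩ := exists_norm_pochNormalized_le a
  obtain ⟨B, hB, hB'⟩ := exists_norm_pochNormalized_le b
  obtain ⟨E, hE, hE'⟩ := exists_norm_inv_pochNormalized_le he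
  refine ⟨A * B * E, by positivity, fun k => ?_⟩
  have hn : ((k + 1 : ℕ) : ℂ) ≠ 0 := by exact_mod_cast k.succ_ne_zero
  have hf : (k.factorial : ℂ) ≠ 0 := by exact_mod_cast k.factorial_ne_zero
  have h3 := pochNormalized_ne_zero he k
  have e1 : gaussTerm a b e k = pochNormalized a k * pochNormalized b k * (pochNormalized e k)⁻¹ *
      ((k + 1 : ℕ) : ℂ) ^ (-(e - a - b) - 1) := by
    have hpow : ((k + 1 : ℕ) : ℂ) ^ (a - 1) * ((k + 1 : ℕ) : ℂ) ^ (b - 1) =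
        ((k + 1 : ℕ) : ℂ) ^ (-(e - a - b) - 1) * ((k + 1 : ℕ) : ℂ) ^ (e - 1) := by
      rw [← cpow_add _ _ hn, ← cpow_add _ _ hn]
      congr 1
      ring
    simp only [gaussTerm, poch_eq_pochNormalized_mul]
    have h2 := natCast_succ_cpow_ne_zero k (e - 1)
    rw [div_eq_iff (by positivity)]
    field_simp
    linear_combination (pochNormalized a k * pochNormalized b k) * hpow
  rw [e1, norm_mul, norm_mul, norm_mul, norm_natCast_cpow_of_pos k.succ_pos]
  have := hA' k
  have := hB' k
  have := hE' k
  simp only [sub_re, neg_re, one_re]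
  gcongr

theorem summable_add_one_rpow {p : ℝ} (hp : p < -1) :
    Summable fun k : ℕ => ((k + 1 : ℕ) : ℝ) ^ p :=
  (summable_nat_add_iff 1).2 (Real.summable_nat_rpow.2 hp)

theorem summable_norm_gaussTerm {a b e : ℂ} (he : ∀ m : ℕ, e ≠ -(m : ℂ))
    (hre : 0 < (e - a - b).re) : Summable fun k => ‖gaussTerm a b e k‖ := by
  obtain ⟨K, -, hK'⟩ := exists_norm_gaussTerm_le a b he
  exact ((summable_add_one_rpow (by linarith)).mul_left K).of_nonneg_of_le
    (fun _ => norm_nonneg _) hK'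

theorem tendsto_natCast_mul_gaussTerm {a b e : ℂ} (he : ∀ m : ℕ, e ≠ -(m : ℂ))
    (hre : 0 < (e - a - b).re) :
    Tendsto (fun k : ℕ => (k : ℂ) * gaussTerm a b e k) atTop (nhds 0) := by
  obtain ⟨K, hK, hK'⟩ := exists_norm_gaussTerm_le a b he
  have h0 : Tendsto (fun k : ℕ => K * ((k + 1 : ℕ) : ℝ) ^ (-(e - a - b).re)) atTop (nhds 0) := by
    have := ((tendsto_rpow_neg_atTop hre).comp
      (tendsto_natCast_atTop_atTop.comp (tendsto_add_atTop_nat 1))).const_mul K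
    simpa using this
  refine squeeze_zero_norm (fun k => ?_) h0
  have hk : (0 : ℝ) < ((k + 1 : ℕ) : ℝ) := by positivity
  rw [norm_mul, norm_natCast]
  calc (k : ℝ) * ‖gaussTerm a b e k‖
      ≤ ((k + 1 : ℕ) : ℝ) * (K * ((k + 1 : ℕ) : ℝ) ^ (-(e - a - b).re - 1)) := by
        gcongr
        · simp
        · exact hK' k
    _ = K * ((k + 1 : ℕ) : ℝ) ^ (-(e - a - b).re) := by
        rw [Real.rpow_sub_one hk.ne']
        field_simp

/-- The contiguous relation for `₂F₁(a, b; e; 1)` in the parameter `e`. -/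
theorem tsum_gaussTerm_contiguous {a b e : ℂ} (he : ∀ m : ℕ, e ≠ -(m : ℂ))
    (hre : 0 < (e - a - b).re) :
    e * (e - a - b) * ∑' k, gaussTerm a b e k =
      (e - a) * (e - b) * ∑' k, gaussTerm a b (e + 1) k := by
  have he1 : ∀ m : ℕ, e + 1 ≠ -(m : ℂ) := by
    simpa using add_natCast_ne_neg_natCast he 1
  have hre1 : 0 < (e + 1 - a - b).re := by
    simp at hre ⊢
    linarith
  have s0 := (summable_norm_gaussTerm he hre).of_norm.mul_left (e * (e - a - b))
  have s1 := (summable_norm_gaussTerm he1 hre1).of_norm.mul_left ((e - a) * (e - b))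
  have tele (k : ℕ) : e * (e - a - b) * gaussTerm a b e k
      - (e - a) * (e - b) * gaussTerm a b (e + 1) k =
      -e * (((k + 1 : ℕ) : ℂ) * gaussTerm a b e (k + 1)) - -e * ((k : ℂ) * gaussTerm a b e k) := by
    have hek : e + k ≠ 0 := fun h => he k (eq_neg_of_add_eq_zero_left h)
    have he0 : e ≠ 0 := by simpa using he 0
    have hf : (k.factorial : ℂ) ≠ 0 := by exact_mod_cast k.factorial_ne_zero
    have hk1 : (k : ℂ) + 1 ≠ 0 := by exact_mod_cast k.succ_ne_zero
    have hp := poch_ne_zero he k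
    have e1 : poch (e + 1) k = poch e k * (e + k) / e := by
      rw [eq_div_iff he0, ← poch_succ, add_comm k 1, poch_add]
      simp [poch]
      ring
    simp only [gaussTerm, poch_succ, e1, Nat.factorial_succ]
    push_cast
    field_simp
    ring
  have t := (s0.sub s1).hasSum.tendsto_sum_nat
  simp only [tele] at t
  simp only [Finset.sum_range_sub (fun k : ℕ => -e * ((k : ℂ) * gaussTerm a b e k))] at t
  have t0 := (tendsto_natCast_mul_gaussTerm he hre).const_mul (-e)
  have := tendsto_nhds_unique t (by simpa using t0)
  simp only [← tele] at this
  rw [s0.tsum_sub s1, tsum_mul_left, tsum_mul_left] at this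
  exact sub_eq_zero.1 this

theorem poch_mul_tsum_gaussTerm {a b e : ℂ} (he : ∀ m : ℕ, e ≠ -(m : ℂ))
    (hre : 0 < (e - a - b).re) (n : ℕ) :
    poch e n * poch (e - a - b) n * ∑' k, gaussTerm a b e k =
      poch (e - a) n * poch (e - b) n * ∑' k, gaussTerm a b (e + n) k := by
  induction n with
  | zero => simp [poch]
  | succ n ih =>
    have hre' : 0 < (e + n - a - b).re := by
      have : (0 : ℝ) ≤ n := n.cast_nonneg
      simp at hre ⊢
      linarith
    have h := tsum_gaussTerm_contiguous (add_natCast_ne_neg_natCast he n) hre'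
    have e1 : e + ((n + 1 : ℕ) : ℂ) = e + n + 1 := by push_cast; ring
    simp only [poch_succ, e1]
    linear_combination (e + n) * (e - a - b + n) * ih + poch (e - a) n * poch (e - b) n * h

theorem tendsto_tsum_gaussTerm_add_natCast {a b e : ℂ} (he : ∀ m : ℕ, e ≠ -(m : ℂ))
    (hre : 0 < (e - a - b).re) :
    Tendsto (fun n : ℕ => ∑' k, gaussTerm a b (e + n) k) atTop (nhds 1) := by
  have key : Tendsto (fun n : ℕ => ∑' k, gaussTerm a b (e + n) k) atTop
      (nhds (∑' k : ℕ, if k = 0 then (1 : ℂ) else 0)) := by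
    refine tendsto_tsum_of_dominated_convergence (summable_norm_gaussTerm he hre) ?_ ?_
    · intro k
      rcases k with _ | k
      · simp [gaussTerm, poch]
      · have hfac (i : ℕ) : Tendsto (fun n : ℕ => (e + n + i)⁻¹) atTop (nhds 0) := by
          have h := tendsto_add_mul_div_add_mul_atTop_nhds 1 (e + i) (0 : ℂ) one_ne_zero
          rw [zero_div] at h
          refine h.congr fun n => ?_
          rw [zero_mul, add_zero, one_mul, one_div, add_right_comm]
        have hprod : Tendsto (fun n : ℕ => (poch (e + n) (k + 1))⁻¹) atTop (nhds 0) := by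
          have := tendsto_finsetProd (Finset.range (k + 1)) fun i _ => hfac i
          simpa [poch, Finset.prod_inv_distrib] using this
        have := hprod.const_mul (poch a (k + 1) * poch b (k + 1) / ((k + 1).factorial : ℂ))
        simp only [mul_zero] at this
        simp only [Nat.succ_ne_zero, if_false]
        refine this.congr fun n => ?_
        simp only [gaussTerm, div_eq_mul_inv, mul_inv]
        ring
    · filter_upwards [eventually_ge_atTop ⌈-2 * e.re⌉₊] with n hn k
      have hn' : -2 * e.re ≤ n := Nat.ceil_le.1 hn
      have hle : ‖poch e k‖ ≤ ‖poch (e + n) k‖ := by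
        simp only [poch, norm_prod]
        refine Finset.prod_le_prod (fun _ _ => norm_nonneg _) fun i _ => ?_
        rw [← sq_le_sq₀ (norm_nonneg _) (norm_nonneg _), ← normSq_eq_norm_sq, ← normSq_eq_norm_sq,
          normSq_apply, normSq_apply]
        simp only [add_re, add_im, natCast_re, natCast_im]
        have h1 : (0 : ℝ) ≤ n := n.cast_nonneg
        have h2 : (0 : ℝ) ≤ i := i.cast_nonneg
        nlinarith [mul_nonneg h1 h2]
      have hpos : 0 < ‖poch e k‖ := norm_pos_iff.2 (poch_ne_zero he k)
      have hfpos : 0 < ‖(k.factorial : ℂ)‖ :=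
        norm_pos_iff.2 (by exact_mod_cast k.factorial_ne_zero)
      simp only [gaussTerm, norm_div, norm_mul]
      gcongr
  simpa using key

/-- Gauss's summation theorem for `₂F₁(a, b; e; 1)`. -/
theorem tsum_gaussTerm_eq {a b e : ℂ} (he : ∀ m : ℕ, e ≠ -(m : ℂ))
    (hre : 0 < (e - a - b).re) :
    ∑' k, gaussTerm a b e k =
      Gamma e * Gamma (e - a - b) / (Gamma (e - a) * Gamma (e - b)) := by
  have hs : ∀ m : ℕ, e - a - b ≠ -(m : ℂ) := fun m h => by
    have : (0 : ℝ) ≤ m := m.cast_nonneg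
    rw [h] at hre
    simp at hre
    linarith
  have h1 := (tendsto_poch_mul_div (p := e - a) (q := e - b) (r := e) (s := e - a - b)
    (by ring) he hs).mul (tendsto_tsum_gaussTerm_add_natCast he hre)
  rw [mul_one] at h1
  refine tendsto_nhds_unique (tendsto_const_nhds.congr fun n => ?_) h1
  rw [div_mul_eq_mul_div, ← poch_mul_tsum_gaussTerm he hre n, mul_div_cancel_left₀]
  exact mul_ne_zero (poch_ne_zero he n) (poch_ne_zero hs n)

/-- Uniform bound for ratios of shifted Pochhammer symbols. -/
theorem exists_norm_poch_add_natCast_div_le {c d : ℂ} (hc : ∀ m : ℕ, c ≠ -(m : ℂ))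
    (hd : ∀ m : ℕ, d ≠ -(m : ℂ)) :
    ∃ K : ℝ, 0 < K ∧ ∀ n k : ℕ, ‖poch (c + n) k / poch (d + n) k‖ ≤
      K * ((k + 1 : ℕ) : ℝ) ^ max (c - d).re 0 := by
  obtain ⟨A, hA, hA'⟩ := exists_norm_pochNormalized_le c
  obtain ⟨B, hB, hB'⟩ := exists_norm_pochNormalized_le d
  obtain ⟨C, hC, hC'⟩ := exists_norm_inv_pochNormalized_le hc
  obtain ⟨D, hD, hD'⟩ := exists_norm_inv_pochNormalized_le hd
  refine ⟨A * D * B * C, by positivity, fun n k => ?_⟩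
  have hratio (m : ℕ) : poch c m / poch d m =
      pochNormalized c m * (pochNormalized d m)⁻¹ * ((m + 1 : ℕ) : ℂ) ^ (c - d) := by
    have hm : ((m + 1 : ℕ) : ℂ) ≠ 0 := by exact_mod_cast m.succ_ne_zero
    have hf : (m.factorial : ℂ) ≠ 0 := by exact_mod_cast m.factorial_ne_zero
    have h0 : ((m + 1 : ℕ) : ℂ) ^ (d - 1) ≠ 0 := natCast_succ_cpow_ne_zero _ _
    have h1 := pochNormalized_ne_zero hd m
    have e1 : c - 1 = (c - d) + (d - 1) := by ring
    rw [poch_eq_pochNormalized_mul, poch_eq_pochNormalized_mul, e1, cpow_add _ _ hm,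
      div_eq_iff (by positivity)]
    field_simp
  have hsplit : poch (c + n) k / poch (d + n) k =
      (poch c (n + k) / poch d (n + k)) * (poch c n / poch d n)⁻¹ := by
    have h1 := poch_ne_zero hc n
    have h2 := poch_ne_zero hd n
    rw [poch_add, poch_add]
    field_simp
  rw [hsplit, hratio, hratio]
  simp only [norm_mul, mul_inv, inv_inv, norm_inv (_ ^ _),
    norm_natCast_cpow_of_pos (Nat.succ_pos _)]
  have h1 := hA' (n + k)
  have h2 := hD' (n + k)
  have h3 := hC' n
  have h4 := hB' n
  have hx : (0 : ℝ) < ((n + 1 : ℕ) : ℝ) := by positivity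
  have hy : (0 : ℝ) < ((n + k + 1 : ℕ) : ℝ) := by positivity
  have hz : (1 : ℝ) ≤ ((k + 1 : ℕ) : ℝ) := by simp
  have hpow : ((n + k + 1 : ℕ) : ℝ) ^ (c - d).re * (((n + 1 : ℕ) : ℝ) ^ (c - d).re)⁻¹ ≤
      ((k + 1 : ℕ) : ℝ) ^ max (c - d).re 0 := by
    rw [← div_eq_mul_inv, ← Real.div_rpow hy.le hx.le]
    have hge : (1 : ℝ) ≤ ((n + k + 1 : ℕ) : ℝ) / ((n + 1 : ℕ) : ℝ) := by
      rw [one_le_div hx]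
      exact_mod_cast by omega
    have hle : ((n + k + 1 : ℕ) : ℝ) / ((n + 1 : ℕ) : ℝ) ≤ ((k + 1 : ℕ) : ℝ) := by
      rw [div_le_iff₀ hx]
      exact_mod_cast by nlinarith [Nat.zero_le (n * k)]
    calc _ ≤ (((n + k + 1 : ℕ) : ℝ) / ((n + 1 : ℕ) : ℝ)) ^ max (c - d).re 0 :=
          Real.rpow_le_rpow_of_exponent_le hge (le_max_left _ _)
      _ ≤ _ := Real.rpow_le_rpow (by positivity) hle (le_max_right _ _)
  calc _ = (‖pochNormalized c (n + k)‖ * ‖(pochNormalized d (n + k))⁻¹‖ * ‖pochNormalized d n‖ *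
        ‖(pochNormalized c n)⁻¹‖) * (((n + k + 1 : ℕ) : ℝ) ^ (c - d).re *
          (((n + 1 : ℕ) : ℝ) ^ (c - d).re)⁻¹) := by ring
    _ ≤ _ := by gcongr

theorem tendsto_poch_add_natCast_div (c d : ℂ) (k : ℕ) :
    Tendsto (fun n : ℕ => poch (c + n) k / poch (d + n) k) atTop (nhds 1) := by
  have hfac (i : ℕ) : Tendsto (fun n : ℕ => (c + n + i) / (d + n + i)) atTop (nhds 1) := by
    have h := tendsto_add_mul_div_add_mul_atTop_nhds (c + i) (d + i) (1 : ℂ) one_ne_zero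
    rw [div_one] at h
    refine h.congr fun n => ?_
    rw [one_mul, add_right_comm, add_right_comm d]
  have := tendsto_finsetProd (Finset.range k) fun i _ => hfac i
  simpa [poch, Finset.prod_div_distrib] using this

theorem tendsto_tsum_saalschutz {a b c d e : ℂ} (hre : 0 < (e - a - b).re)
    (hd : d = a + b + c - e + 1)
    (he : ∀ m : ℕ, e ≠ -(m : ℂ)) (hc : ∀ m : ℕ, c ≠ -(m : ℂ)) (hd' : ∀ m : ℕ, d ≠ -(m : ℂ)) :
    Tendsto (fun n : ℕ => ∑' k : ℕ, gaussTerm a b e k * (poch (c + n) k / poch (d + n) k)) atTop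
      (nhds (∑' k, gaussTerm a b e k)) := by
  obtain ⟨K, hK, hK'⟩ := exists_norm_gaussTerm_le a b he
  obtain ⟨M, hM, hM'⟩ := exists_norm_poch_add_natCast_div_le hc hd'
  have hcd : (c - d).re = (e - a - b).re - 1 := by
    rw [hd, ← one_re, ← sub_re]
    congr 1
    ring
  have hexp : -(e - a - b).re - 1 + max (c - d).re 0 < -1 := by
    rcases max_cases (c - d).re 0 with h | h <;> linarith
  refine tendsto_tsum_of_dominated_convergence
    ((summable_add_one_rpow hexp).mul_left (K * M)) (fun k => ?_) (.of_forall fun n k => ?_)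
  · simpa using (tendsto_poch_add_natCast_div c d k).const_mul (gaussTerm a b e k)
  · rw [norm_mul, Real.rpow_add (by positivity)]
    calc _ ≤ (K * ((k + 1 : ℕ) : ℝ) ^ (-(e - a - b).re - 1)) *
          (M * ((k + 1 : ℕ) : ℝ) ^ max (c - d).re 0) := by
          gcongr
          · exact hK' k
          · exact hM' n k
      _ = _ := by ring

theorem saalschutz_S_limit (a b c e : ℂ) (hre : 0 < (e - a - b).re)
    (he : ∀ m : ℕ, e ≠ -(m : ℂ)) (hc : ∀ m : ℕ, c ≠ -(m : ℂ))
    (h1 : ∀ m : ℕ, a + c - e + 1 ≠ -(m : ℂ))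
    (h2 : ∀ m : ℕ, b + c - e + 1 ≠ -(m : ℂ))
    (h3 : ∀ m : ℕ, a + b + c - e + 1 ≠ -(m : ℂ)) :
    Tendsto (fun n : ℕ => Ssaal a b c e n) atTop
      (nhds (Complex.Gamma e * Complex.Gamma (e - a - b) /
        (Complex.Gamma (e - a) * Complex.Gamma (e - b)))) := by
  have key := (tendsto_Gamma_mul_div (p := a + c - e + 1) (q := b + c - e + 1) (r := c - e + 1)
    (s := a + b + c - e + 1) (by ring)).mul (tendsto_tsum_saalschutz hre rfl he hc h3)
  rw [one_mul, tsum_gaussTerm_eq he hre] at key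
  refine key.congr fun n => ?_
  rw [Ssaal]
  congr 1
  refine tsum_congr fun k => ?_
  rw [gaussTerm, div_mul_div_comm]
  congr 1
  ring
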